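/- There is no truthful mechanism that always outputs envy-free and Pareto-optimal allocations, even in the unconstrained setting with 2 agents and 2 divisible goods. Precisely: there is no function M mapping each valuation profile (v_1, v_2) with nonnegative values v_{i,g} to an allocation of the 2 goods between the 2 agents such that (i) M(v_1, v_2) is envy-free and Pareto-optimal for every profile, and (ii) M is truthful, i.e., no agent can strictly increase her value (with respect to her true valuation) by reporting a different valuation. -/

import Mathlib

open Finset

lemma region_aux (a b p q r s : ℝ) (hb : 1 < b) (hab : b < a)
    (hp : 0 ≤ p) (hq : 0 ≤ q) (hr : 0 ≤ r) (hs : 0 ≤ s)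
    (h1 : p + r ≤ 1) (h2 : q + s ≤ 1)
    (e0 : r * a + s ≤ p * a + q) (e1 : p * b + q ≤ r * b + s)
    (hpo : ∀ x y z w : ℝ, 0 ≤ x → 0 ≤ y → 0 ≤ z → 0 ≤ w → x + z ≤ 1 → y + w ≤ 1 →
      p * a + q ≤ x * a + y → r * b + s ≤ z * b + w →
      x * a + y ≤ p * a + q ∧ z * b + w ≤ r * b + s) :
    q = 0 ∧ s = 1 ∧ r = 1 - p ∧ a + 1 ≤ 2 * (p * a) ∧ 2 * (p * b) ≤ b + 1 := by
  have hr1 : r = 1 - p := by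
    have := (hpo (1 - r) q r s (by linarith) hq hr hs (by linarith) h2
      (by nlinarith) le_rfl).1
    nlinarith
  have hs1 : s = 1 - q := by
    have := (hpo p (1 - s) r s hp (by linarith) hr hs h1 (by linarith)
      (by linarith) le_rfl).1
    linarith
  subst hr1 hs1
  have hq0 : q = 0 := by
    by_contra hne
    have hq' : 0 < q := lt_of_le_of_ne hq (Ne.symm hne)
    have hp1 : 0 < 1 - p := by nlinarith
    set t := min q (1 - p) with ht
    have t0 : 0 < t := lt_min hq' hp1
    have tq : t ≤ q := min_le_left _ _
    have tp : t ≤ 1 - p := min_le_right _ _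
    have hsum : 0 < a + b := by linarith
    have key : 2 * t / (a + b) * (a + b) = 2 * t := div_mul_cancel₀ _ hsum.ne'
    set e := 2 * t / (a + b) with he
    have e0' : 0 < e := div_pos (by linarith) hsum
    have et : e ≤ t := by nlinarith
    have ea : t < e * a := by nlinarith
    have eb : e * b < t := by nlinarith
    have := (hpo (p + e) (q - t) (1 - p - e) (1 - q + t) (by linarith) (by linarith)
      (by linarith) (by linarith) (by linarith) (by linarith) (by linarith) (by linarith)).1
    linarith
  subst hq0
  refine ⟨rfl, by ring, rfl, by linarith, by linarith⟩

/-- There is no truthful mechanism that always outputs envy-free and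
Pareto-optimal allocations, even in the unconstrained setting with 2 agents and 2 divisible
goods. A mechanism maps each reported (nonnegative, additive) valuation profile
`v : Fin 2 → Fin 2 → ℝ` to an allocation `M v : Fin 2 → Fin 2 → ℝ`. -/
theorem no_truthful_ef_po_mechanism :
    ¬ ∃ M : (Fin 2 → Fin 2 → ℝ) → (Fin 2 → Fin 2 → ℝ),
      -- (i) on every nonnegative profile, M outputs an envy-free and Pareto-optimal allocation
      (∀ v : Fin 2 → Fin 2 → ℝ, (∀ i g, 0 ≤ v i g) →
        -- valid allocation
        (∀ i g, 0 ≤ M v i g ∧ M v i g ≤ 1) ∧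
        (∀ g, ∑ i, M v i g ≤ 1) ∧
        -- envy-freeness towards the other agent and towards the charity
        (∀ i j : Fin 2, ∑ g, M v j g * v i g ≤ ∑ g, M v i g * v i g) ∧
        (∀ i : Fin 2, ∑ g, (1 - ∑ k, M v k g) * v i g ≤ ∑ g, M v i g * v i g) ∧
        -- Pareto-optimality
        (¬ ∃ x' : Fin 2 → Fin 2 → ℝ,
          (∀ i g, 0 ≤ x' i g ∧ x' i g ≤ 1) ∧ (∀ g, ∑ i, x' i g ≤ 1) ∧
          (∀ i, ∑ g, M v i g * v i g ≤ ∑ g, x' i g * v i g) ∧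
          (∃ i, ∑ g, M v i g * v i g < ∑ g, x' i g * v i g))) ∧
      -- (ii) truthfulness: no agent can strictly gain (w.r.t. her true valuation `v i`)
      -- by reporting `v'` instead of `v i`, the other agent's report being fixed
      (∀ v : Fin 2 → Fin 2 → ℝ, (∀ i g, 0 ≤ v i g) →
        ∀ (i : Fin 2) (v' : Fin 2 → ℝ), (∀ g, 0 ≤ v' g) →
        ∑ g, M (Function.update v i v') i g * v i g ≤ ∑ g, M v i g * v i g) := by
  rintro ⟨M, hM, hT⟩
  have nn : ∀ a b : ℝ, 1 < b → b < a → ∀ i g, 0 ≤ (![![a, 1], ![b, 1]] : Fin 2 → Fin 2 → ℝ) i g := by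
    intro a b hb hab i g
    fin_cases i <;> fin_cases g <;> simp <;> linarith
  have key : ∀ a b : ℝ, 1 < b → b < a →
      M ![![a, 1], ![b, 1]] 0 1 = 0 ∧ M ![![a, 1], ![b, 1]] 1 1 = 1 ∧
      M ![![a, 1], ![b, 1]] 1 0 = 1 - M ![![a, 1], ![b, 1]] 0 0 ∧
      a + 1 ≤ 2 * (M ![![a, 1], ![b, 1]] 0 0 * a) ∧
      2 * (M ![![a, 1], ![b, 1]] 0 0 * b) ≤ b + 1 := by
    intro a b hb hab
    obtain ⟨hv, hs, he, -, hpo⟩ := hM _ (nn a b hb hab)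
    have s0 := hs 0
    have s1 := hs 1
    have e0 := he 0 1
    have e1 := he 1 0
    simp only [Fin.sum_univ_two] at s0 s1
    simp [Fin.sum_univ_two] at e0 e1
    refine region_aux a b _ _ _ _ hb hab (hv 0 0).1 (hv 0 1).1 (hv 1 0).1 (hv 1 1).1 s0 s1 e0 e1 ?_
    intro x y z w hx hy hz hw hxz hyw i0 i1
    by_contra hcon
    apply hpo
    refine ⟨![![x, y], ![z, w]], ?_, ?_, ?_, ?_⟩
    · intro i g
      fin_cases i <;> fin_cases g <;> simp <;> constructor <;> linarith
    · intro g
      fin_cases g <;> simp [Fin.sum_univ_two] <;> linarith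
    · intro i
      fin_cases i <;> simp [Fin.sum_univ_two] <;> linarith
    · by_cases h : x * a + y ≤ M ![![a, 1], ![b, 1]] 0 0 * a + M ![![a, 1], ![b, 1]] 0 1
      · have h' := fun h'' => hcon ⟨h, h''⟩
        refine ⟨1, ?_⟩
        simpa [Fin.sum_univ_two] using h'
      · refine ⟨0, ?_⟩
        simpa [Fin.sum_univ_two] using h
  have u0 : ∀ a a' b : ℝ, Function.update (![![a, 1], ![b, 1]] : Fin 2 → Fin 2 → ℝ) 0 ![a', 1]
      = ![![a', 1], ![b, 1]] := by
    intro a a' b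
    funext i
    fin_cases i <;> simp
  have u1 : ∀ a b b' : ℝ, Function.update (![![a, 1], ![b, 1]] : Fin 2 → Fin 2 → ℝ) 1 ![b', 1]
      = ![![a, 1], ![b', 1]] := by
    intro a b b'
    funext i
    fin_cases i <;> simp
  have nn1 : ∀ c : ℝ, 0 ≤ c → ∀ g, 0 ≤ (![c, 1] : Fin 2 → ℝ) g := by
    intro c hc g
    fin_cases g <;> simp [hc]
  obtain ⟨k1, k2, k3, k4, k5⟩ := key 3 2 (by norm_num) (by norm_num)
  obtain ⟨l1, l2, l3, l4, l5⟩ := key 5 2 (by norm_num) (by norm_num)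
  obtain ⟨m1, m2, m3, m4, m5⟩ := key 5 4 (by norm_num) (by norm_num)
  have t1 := hT _ (nn 5 2 (by norm_num) (by norm_num)) 0 ![3, 1] (nn1 3 (by norm_num))
  have t2 := hT _ (nn 5 4 (by norm_num) (by norm_num)) 1 ![2, 1] (nn1 2 (by norm_num))
  have t3 := hT _ (nn 5 2 (by norm_num) (by norm_num)) 1 ![4, 1] (nn1 4 (by norm_num))
  rw [u0] at t1
  rw [u1] at t2 t3
  simp [Fin.sum_univ_two] at t1 t2 t3
  linarith
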